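/- Let ζ₇ = exp(2πi/7), S = diag(ζ₇, ζ₇², ζ₇⁴), T the permutation matrix [[0,1,0],[0,0,1],[1,0,0]], R = (i/√7)·[[ζ₇⁴−ζ₇³, ζ₇²−ζ₇⁵, ζ₇−ζ₇⁶],[ζ₇²−ζ₇⁵, ζ₇−ζ₇⁶, ζ₇⁴−ζ₇³],[ζ₇−ζ₇⁶, ζ₇⁴−ζ₇³, ζ₇²−ζ₇⁵]], and let Γ ⊂ SL₃(ℂ) be the subgroup generated by S, T, R (the exceptional subgroup of type I). Then in ℂ⟦t⟧: (t−1)³·(t²+t+1)·(t²+1)·(t+1)²·(t⁶+t⁵+t⁴+t³+t²+t+1)·Σₘ dim_ℂ((Symᵐ(ℂ³))^Γ)·tᵐ = −t¹² − t¹¹ + t⁹ + t⁸ − t⁶ + t⁴ + t³ − t − 1. -/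

import Mathlib

open Matrix Complex PowerSeries CategoryTheory

/-- Index of the monomial basis `e₁^a e₂^b e₃^(m-a-b)` (with `a + b ≤ m`) of the `m`-th
symmetric power `Symᵐ(ℂ³)`. -/
abbrev SymIdx3 (m : ℕ) : Type :=
  {p : Fin (m + 1) × Fin (m + 1) // (p.1 : ℕ) + (p.2 : ℕ) ≤ m}

/-- The image of the basis vector `e_j` of `ℂ³` under `g`, as a linear polynomial in
`X 0 ↔ e₁`, `X 1 ↔ e₂`, `X 2 ↔ e₃`. -/
noncomputable def symCol3 (g : Matrix (Fin 3) (Fin 3) ℂ) (j : Fin 3) :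
    MvPolynomial (Fin 3) ℂ :=
  ∑ i : Fin 3, MvPolynomial.C (g i j) * MvPolynomial.X i

/-- The image of the basis vector `e₁^a e₂^b e₃^(m-a-b)` of `Symᵐ(ℂ³)` under the
endomorphism induced by `g`, written as a polynomial. -/
noncomputable def symPoly3 (m : ℕ) (g : Matrix (Fin 3) (Fin 3) ℂ) (k : SymIdx3 m) :
    MvPolynomial (Fin 3) ℂ :=
  symCol3 g 0 ^ (k.1.1 : ℕ) * symCol3 g 1 ^ (k.1.2 : ℕ) *
    symCol3 g 2 ^ (m - (k.1.1 : ℕ) - (k.1.2 : ℕ))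

/-- The monomial exponent vector attached to a basis index of `Symᵐ(ℂ³)`. -/
noncomputable def symMono3 (m : ℕ) (p : SymIdx3 m) : Fin 3 →₀ ℕ :=
  Finsupp.single 0 (p.1.1 : ℕ) + Finsupp.single 1 (p.1.2 : ℕ) +
    Finsupp.single 2 (m - (p.1.1 : ℕ) - (p.1.2 : ℕ))

/-- The matrix of the endomorphism `Symᵐ(g)` induced by `g` on the `m`-th symmetric power
of `ℂ³`, in the basis of monomials `e₁^a e₂^b e₃^(m-a-b)`. -/
noncomputable def symMatrix3 (m : ℕ) (g : Matrix (Fin 3) (Fin 3) ℂ) :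
    Matrix (SymIdx3 m) (SymIdx3 m) ℂ :=
  Matrix.of fun i k => MvPolynomial.coeff (symMono3 m i) (symPoly3 m g k)

/-- The subspace of `Γ`-invariant vectors in the `m`-th symmetric power of `ℂ³`
(in the monomial-basis coordinates given by `symMatrix3`). -/
noncomputable def symInvariants3 (Γ : Subgroup (SpecialLinearGroup (Fin 3) ℂ)) (m : ℕ) :
    Submodule ℂ (SymIdx3 m → ℂ) where
  carrier := {v | ∀ g ∈ Γ, (symMatrix3 m (g : Matrix (Fin 3) (Fin 3) ℂ)).mulVec v = v}
  add_mem' := by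
    intro a b ha hb g hg
    rw [Matrix.mulVec_add, ha g hg, hb g hg]
  zero_mem' := by
    intro g hg
    rw [Matrix.mulVec_zero]
  smul_mem' := by
    intro c x hx g hg
    rw [Matrix.mulVec_smul, hx g hg]

theorem symMono3_injective (m : ℕ) : Function.Injective (symMono3 m) := by
  rintro ⟨⟨a, b⟩, h⟩ ⟨⟨a', b'⟩, h'⟩ e
  have h0 := DFunLike.congr_fun e 0
  have h1 := DFunLike.congr_fun e 1
  simp [symMono3] at h0 h1
  simp [Fin.ext_iff, h0, h1]

theorem degree_symMono3 (m : ℕ) (k : SymIdx3 m) : (symMono3 m k).degree = m := by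
  have := k.2
  rw [Finsupp.degree_eq_sum, Fin.sum_univ_three]
  simp [symMono3]
  omega

theorem exists_symMono3_eq (m : ℕ) (d : Fin 3 →₀ ℕ) (hd : d.degree = m) :
    ∃ k, symMono3 m k = d := by
  rw [Finsupp.degree_eq_sum, Fin.sum_univ_three] at hd
  refine ⟨⟨(⟨d 0, by omega⟩, ⟨d 1, by omega⟩), by dsimp only; omega⟩, ?_⟩
  ext i
  fin_cases i <;> (simp [symMono3]; try omega)

/-- A homogeneous polynomial of degree `m` is the sum of its terms indexed by `SymIdx3 m`. -/
theorem MvPolynomial.IsHomogeneous.eq_sum_symMono3 {m : ℕ} {p : MvPolynomial (Fin 3) ℂ}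
    (hp : p.IsHomogeneous m) :
    p = ∑ k : SymIdx3 m, MvPolynomial.C (p.coeff (symMono3 m k)) *
      MvPolynomial.monomial (symMono3 m k) 1 := by
  classical
  ext d
  simp only [MvPolynomial.coeff_sum, MvPolynomial.coeff_C_mul, MvPolynomial.coeff_monomial]
  by_cases hd : d.degree = m
  · obtain ⟨k, rfl⟩ := exists_symMono3_eq m d hd
    simp [(symMono3_injective m).eq_iff]
  · rw [hp.coeff_eq_zero hd, Finset.sum_eq_zero]
    intro k _
    rw [if_neg, mul_zero]
    rintro rfl
    exact hd (degree_symMono3 m k)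

theorem aeval_symCol3_monomial (m : ℕ) (g : Matrix (Fin 3) (Fin 3) ℂ) (k : SymIdx3 m) :
    MvPolynomial.aeval (symCol3 g) (MvPolynomial.monomial (symMono3 m k) (1 : ℂ)) =
      symPoly3 m g k := by
  rw [MvPolynomial.aeval_monomial, Finsupp.prod_fintype _ _ (fun _ => pow_zero _),
    Fin.prod_univ_three]
  simp [symPoly3, symMono3]

theorem aeval_symCol3_symCol3 (g h : Matrix (Fin 3) (Fin 3) ℂ) (j : Fin 3) :
    MvPolynomial.aeval (symCol3 g) (symCol3 h j) = symCol3 (g * h) j := by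
  simp only [symCol3, map_mul, MvPolynomial.aeval_X, MvPolynomial.algHom_C,
    MvPolynomial.algebraMap_eq, Matrix.mul_apply, Fin.sum_univ_three, map_add]
  ring

theorem isHomogeneous_symCol3 (g : Matrix (Fin 3) (Fin 3) ℂ) (j : Fin 3) :
    (symCol3 g j).IsHomogeneous 1 :=
  MvPolynomial.IsHomogeneous.sum _ _ _ fun i _ => (MvPolynomial.isHomogeneous_X ℂ i).C_mul _

theorem isHomogeneous_symPoly3 (m : ℕ) (g : Matrix (Fin 3) (Fin 3) ℂ) (k : SymIdx3 m) :
    (symPoly3 m g k).IsHomogeneous m := by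
  have h := (((isHomogeneous_symCol3 g 0).pow (k.1.1 : ℕ)).mul
    ((isHomogeneous_symCol3 g 1).pow (k.1.2 : ℕ))).mul
    ((isHomogeneous_symCol3 g 2).pow (m - (k.1.1 : ℕ) - (k.1.2 : ℕ)))
  have hk := k.2
  rwa [show 1 * (k.1.1 : ℕ) + 1 * (k.1.2 : ℕ) + 1 * (m - (k.1.1 : ℕ) - (k.1.2 : ℕ)) = m by
    omega] at h

theorem symMatrix3_mul (m : ℕ) (g h : Matrix (Fin 3) (Fin 3) ℂ) :
    symMatrix3 m (g * h) = symMatrix3 m g * symMatrix3 m h := by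
  ext i k
  have key : symPoly3 m (g * h) k = MvPolynomial.aeval (symCol3 g) (symPoly3 m h k) := by
    simp only [symPoly3, map_mul, map_pow, aeval_symCol3_symCol3]
  rw [Matrix.mul_apply]
  simp only [symMatrix3, Matrix.of_apply]
  rw [key, (isHomogeneous_symPoly3 m h k).eq_sum_symMono3, map_sum, MvPolynomial.coeff_sum]
  refine Finset.sum_congr rfl fun l _ => ?_
  rw [map_mul, aeval_symCol3_monomial, MvPolynomial.algHom_C, MvPolynomial.algebraMap_eq,
    MvPolynomial.coeff_C_mul, ← (isHomogeneous_symPoly3 m h k).eq_sum_symMono3, mul_comm]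

theorem symMatrix3_one (m : ℕ) : symMatrix3 m 1 = 1 := by
  classical
  ext i k
  have h : symCol3 1 = (MvPolynomial.X : Fin 3 → MvPolynomial (Fin 3) ℂ) := by
    ext1 j
    fin_cases j <;> simp [symCol3, Matrix.one_apply]
  simp only [symMatrix3, Matrix.of_apply]
  rw [← aeval_symCol3_monomial, h, MvPolynomial.aeval_X_left_apply, MvPolynomial.coeff_monomial,
    Matrix.one_apply]
  simp [(symMono3_injective m).eq_iff, eq_comm]

/-- The `m`-th symmetric power as a monoid homomorphism on matrices. -/
noncomputable def symMatrixHom3 (m : ℕ) :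
    Matrix (Fin 3) (Fin 3) ℂ →* Matrix (SymIdx3 m) (SymIdx3 m) ℂ where
  toFun := symMatrix3 m
  map_one' := symMatrix3_one m
  map_mul' := symMatrix3_mul m

open MonomialOrder in
theorem lex_degree_add_eq {p q : MvPolynomial (Fin 3) ℂ} {c : ℂ} (hc : c ≠ 0) (j : Fin 3)
    (hp : p = MvPolynomial.C c * MvPolynomial.X j + q)
    (hq : ∀ d ∈ q.support, toLex d < toLex (Finsupp.single j 1)) :
    lex.degree p = Finsupp.single j 1 ∧ lex.leadingCoeff p = c := by
  classical
  have hdeg : lex.degree (MvPolynomial.C c * MvPolynomial.X j : MvPolynomial (Fin 3) ℂ) =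
      Finsupp.single j 1 := by
    rw [MvPolynomial.C_mul_X_eq_monomial, degree_monomial, if_neg hc]
  have hlt : q ≠ 0 → lex.degree q ≺[lex]
      lex.degree (MvPolynomial.C c * MvPolynomial.X j : MvPolynomial (Fin 3) ℂ) := by
    intro h0
    rw [hdeg, lex_lt_iff]
    exact hq _ (degree_mem_support h0)
  have hlc : lex.leadingCoeff (MvPolynomial.C c * MvPolynomial.X j : MvPolynomial (Fin 3) ℂ) =
      c := by
    rw [MvPolynomial.C_mul_X_eq_monomial, leadingCoeff_monomial]
  by_cases h0 : q = 0
  · rw [hp, h0, add_zero]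
    exact ⟨hdeg, hlc⟩
  · rw [hp, degree_add_of_lt (hlt h0), leadingCoeff_add_of_lt (hlt h0)]
    exact ⟨hdeg, hlc⟩

open MonomialOrder in
theorem lex_degree_symCol3 {L : Matrix (Fin 3) (Fin 3) ℂ}
    (hL : ∀ i j, i < j → L i j = 0) (j : Fin 3) (hj : L j j ≠ 0) :
    lex.degree (symCol3 L j) = Finsupp.single j 1 ∧ lex.leadingCoeff (symCol3 L j) = L j j := by
  classical
  refine lex_degree_add_eq hj j (Finset.univ.add_sum_erase _ (Finset.mem_univ j)).symm ?_
  intro d hd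
  rw [MvPolynomial.mem_support_iff, MvPolynomial.coeff_sum] at hd
  obtain ⟨i, hi, hne⟩ := Finset.exists_ne_zero_of_sum_ne_zero hd
  rw [MvPolynomial.coeff_C_mul, MvPolynomial.coeff_X] at hne
  have hij : i ≠ j := Finset.ne_of_mem_erase hi
  have hji : j < i := by
    rcases lt_or_gt_of_ne hij with h | h
    · simp [hL i j h] at hne
    · exact h
  have hd : Finsupp.single i 1 = d := by
    by_contra h
    simp [h] at hne
  rw [← hd]
  exact Finsupp.Lex.single_lt_iff.2 hji

open MonomialOrder in
theorem trace_symMatrix3_of_lower {L : Matrix (Fin 3) (Fin 3) ℂ}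
    (hL : ∀ i j, i < j → L i j = 0) (hd : ∀ j, L j j ≠ 0) (m : ℕ) :
    (symMatrix3 m L).trace = ∑ k : SymIdx3 m,
      L 0 0 ^ (k.1.1 : ℕ) * L 1 1 ^ (k.1.2 : ℕ) * L 2 2 ^ (m - (k.1.1 : ℕ) - (k.1.2 : ℕ)) := by
  refine Finset.sum_congr rfl fun k _ => ?_
  have h := fun j => lex_degree_symCol3 hL j (hd j)
  have hne : ∀ j n, symCol3 L j ^ n ≠ 0 := fun j n => pow_ne_zero _ <| by
    rw [← lex.leadingCoeff_ne_zero_iff, (h j).2]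
    exact hd j
  have hdeg : lex.degree (symPoly3 m L k) = symMono3 m k := by
    rw [symPoly3, degree_mul (mul_ne_zero (hne _ _) (hne _ _)) (hne _ _),
      degree_mul (hne _ _) (hne _ _), degree_pow, degree_pow, degree_pow, (h 0).1, (h 1).1,
      (h 2).1]
    simp [symMono3]
  have hlc : lex.leadingCoeff (symPoly3 m L k) = L 0 0 ^ (k.1.1 : ℕ) * L 1 1 ^ (k.1.2 : ℕ) *
      L 2 2 ^ (m - (k.1.1 : ℕ) - (k.1.2 : ℕ)) := by
    simp only [symPoly3, leadingCoeff_mul, leadingCoeff_pow, (h _).2]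
  rw [← hlc, MonomialOrder.leadingCoeff, hdeg]
  rfl

theorem exists_conj_mulVec_single {n : ℕ} (A : Matrix (Fin (n + 1)) (Fin (n + 1)) ℂ) :
    ∃ P Q : Matrix (Fin (n + 1)) (Fin (n + 1)) ℂ, P * Q = 1 ∧ Q * P = 1 ∧
      ∀ i, i ≠ Fin.last n → (Q * A * P) i (Fin.last n) = 0 := by
  obtain ⟨x, hx⟩ := Module.End.exists_eigenvalue (Matrix.toLin' A)
  obtain ⟨v, hv⟩ := hx.exists_hasEigenvector
  have hs : (Pi.single (Fin.last n) 1 : Fin (n + 1) → ℂ) ≠ 0 := by simp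
  obtain ⟨e, he⟩ := SeparatingDual.exists_continuousLinearEquiv_apply_eq (R := ℂ) hs hv.2
  have hPQ : LinearMap.toMatrix' e.toLinearEquiv.toLinearMap *
      LinearMap.toMatrix' e.toLinearEquiv.symm.toLinearMap = 1 := by
    rw [← LinearMap.toMatrix'_comp, ← LinearMap.toMatrix'_id]
    congr 1
    ext
    simp
  refine ⟨_, _, hPQ, mul_eq_one_comm.1 hPQ, fun i hi => ?_⟩
  have hAv : A.mulVec v = x • v := by simpa using hv.apply_eq_smul
  have hsv : e.symm v = Pi.single (Fin.last n) 1 := by rw [← he, e.symm_apply_apply]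
  have hP : (LinearMap.toMatrix' e.toLinearEquiv.toLinearMap).mulVec
      (Pi.single (Fin.last n) 1) = v := by
    rw [LinearMap.toMatrix'_mulVec]
    exact he
  have hQ : (LinearMap.toMatrix' e.toLinearEquiv.symm.toLinearMap).mulVec v =
      Pi.single (Fin.last n) 1 := by
    rw [LinearMap.toMatrix'_mulVec]
    exact hsv
  have h : ∀ M : Matrix (Fin (n + 1)) (Fin (n + 1)) ℂ,
      M i (Fin.last n) = M.mulVec (Pi.single (Fin.last n) 1) i := by
    simp
  refine (h _).trans ?_
  rw [← Matrix.mulVec_mulVec, ← Matrix.mulVec_mulVec, hP, hAv, Matrix.mulVec_smul, hQ]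
  simp [hi]

/-- Every complex `3 × 3` matrix is similar to a lower triangular one. -/
theorem exists_conj_lower (A : Matrix (Fin 3) (Fin 3) ℂ) :
    ∃ P Q : Matrix (Fin 3) (Fin 3) ℂ, P * Q = 1 ∧ Q * P = 1 ∧
      ∀ i j, i < j → (Q * A * P) i j = 0 := by
  obtain ⟨P, Q, hPQ, hQP, h⟩ : ∃ P Q : Matrix (Fin 3) (Fin 3) ℂ,
      P * Q = 1 ∧ Q * P = 1 ∧ ∀ i, i ≠ 2 → (Q * A * P) i 2 = 0 := exists_conj_mulVec_single A
  set B := Q * A * P with hB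
  obtain ⟨U, V, hUV, hVU, h'⟩ : ∃ U V : Matrix (Fin 2) (Fin 2) ℂ,
      U * V = 1 ∧ V * U = 1 ∧ ∀ i, i ≠ 1 →
        (V * !![B 0 0, B 0 1; B 1 0, B 1 1] * U) i 1 = 0 := exists_conj_mulVec_single !![B 0 0, B 0 1; B 1 0, B 1 1]
  have embed : ∀ U V : Matrix (Fin 2) (Fin 2) ℂ, U * V = 1 →
      !![U 0 0, U 0 1, 0; U 1 0, U 1 1, 0; 0, 0, 1] *
        !![V 0 0, V 0 1, 0; V 1 0, V 1 1, 0; 0, 0, 1] = (1 : Matrix (Fin 3) (Fin 3) ℂ) := by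
    intro U V hUV
    have := fun i j => congrFun (congrFun hUV i) j
    simp only [Matrix.mul_apply, Fin.sum_univ_two] at this
    ext i j
    fin_cases i <;> fin_cases j <;> simp [Matrix.mul_apply, Fin.sum_univ_three, this]
  have h02 : B 0 2 = 0 := h 0 (by decide)
  have h12 : B 1 2 = 0 := h 1 (by decide)
  have h01 := h' 0 (by decide)
  simp only [Matrix.mul_apply, Fin.sum_univ_two] at h01
  simp at h01
  refine ⟨P * !![U 0 0, U 0 1, 0; U 1 0, U 1 1, 0; 0, 0, 1],
    !![V 0 0, V 0 1, 0; V 1 0, V 1 1, 0; 0, 0, 1] * Q, ?_, ?_, ?_⟩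
  · rw [mul_assoc, ← mul_assoc _ _ Q, embed U V hUV, one_mul, hPQ]
  · rw [mul_assoc, ← mul_assoc Q, hQP, one_mul, embed V U hVU]
  · intro i j hij
    have : ∀ X Y : Matrix (Fin 3) (Fin 3) ℂ, X * Q * A * (P * Y) = X * B * Y := by
      intro X Y
      simp only [hB, mul_assoc]
    rw [this]
    fin_cases i <;> fin_cases j <;> first
      | exact absurd hij (by decide)
      | (simp only [Matrix.mul_apply, Fin.sum_univ_three]; simp [h02, h12]; try linear_combination h01)

theorem one_sub_C_mul_X_mul_mk_pow (x : ℂ) :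
    (1 - PowerSeries.C x * PowerSeries.X) * PowerSeries.mk (fun n => x ^ n) = 1 := by
  ext n
  rw [sub_mul, one_mul, map_sub, mul_assoc, PowerSeries.coeff_C_mul, PowerSeries.coeff_mk]
  cases n with
  | zero => simp
  | succ n => simp [PowerSeries.coeff_succ_X_mul, PowerSeries.coeff_one, pow_succ']

theorem mk_sum_symIdx3 (x y z : ℂ) :
    PowerSeries.mk (fun m => ∑ k : SymIdx3 m,
        x ^ (k.1.1 : ℕ) * y ^ (k.1.2 : ℕ) * z ^ (m - (k.1.1 : ℕ) - (k.1.2 : ℕ))) =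
      PowerSeries.mk (fun n => x ^ n) *
        (PowerSeries.mk (fun n => y ^ n) * PowerSeries.mk (fun n => z ^ n)) := by
  ext m
  simp only [PowerSeries.coeff_mul, PowerSeries.coeff_mk, Finset.mul_sum]
  rw [Finset.sum_sigma']
  refine Finset.sum_bij'
    (fun k _ => ⟨((k.1.1 : ℕ), m - (k.1.1 : ℕ)),
      ((k.1.2 : ℕ), m - (k.1.1 : ℕ) - (k.1.2 : ℕ))⟩)
    (fun s hs => ⟨(⟨s.1.1, ?_⟩, ⟨s.2.1, ?_⟩), ?_⟩) ?_ ?_ ?_ ?_ ?_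
  · simp only [Finset.mem_sigma, Finset.HasAntidiagonal.mem_antidiagonal] at hs; omega
  · simp only [Finset.mem_sigma, Finset.HasAntidiagonal.mem_antidiagonal] at hs; omega
  · simp only [Finset.mem_sigma, Finset.HasAntidiagonal.mem_antidiagonal] at hs; dsimp only; omega
  · intro k _
    have := k.2
    simp only [Finset.mem_sigma, Finset.HasAntidiagonal.mem_antidiagonal]
    omega
  · simp
  · intro k _
    rfl
  · rintro ⟨⟨a, b⟩, ⟨c, d⟩⟩ hs
    simp only [Finset.mem_sigma, Finset.HasAntidiagonal.mem_antidiagonal] at hs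
    obtain ⟨h1, h2⟩ := hs
    have hb : m - a = b := by omega
    have hd : m - a - c = d := by omega
    simp only [hd]
    subst hb
    rfl
  · intro k _
    ring

/-- Molien's formula for one matrix of determinant one: the generating function of the traces on
symmetric powers is the inverse of `det (1 - t g)`. -/
theorem molien_mul_trace {g h : Matrix (Fin 3) (Fin 3) ℂ} (hgh : g * h = 1) (hdet : g.det = 1) :
    (1 - PowerSeries.C g.trace * PowerSeries.X + PowerSeries.C h.trace * PowerSeries.X ^ 2
      - PowerSeries.X ^ 3) * PowerSeries.mk (fun m => (symMatrix3 m g).trace) = 1 := by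
  obtain ⟨P, Q, hPQ, hQP, hL⟩ := exists_conj_lower g
  set L := Q * g * P with hLdef
  have trace_conj : ∀ M : Matrix (Fin 3) (Fin 3) ℂ, (Q * M * P).trace = M.trace := by
    intro M
    rw [Matrix.trace_mul_comm, ← mul_assoc, hPQ, one_mul]
  have hLdet : L.det = 1 := by
    rw [hLdef, Matrix.det_mul, Matrix.det_mul, hdet, mul_one, ← Matrix.det_mul, hQP,
      Matrix.det_one]
  have hLL : L * (Q * h * P) = 1 := by
    rw [hLdef, show Q * g * P * (Q * h * P) = Q * (g * (P * Q) * h) * P by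
      simp only [mul_assoc], hPQ, mul_one, hgh, mul_one, hQP]
  have h01 : L 0 1 = 0 := hL 0 1 (by decide)
  have h02 : L 0 2 = 0 := hL 0 2 (by decide)
  have h12 : L 1 2 = 0 := hL 1 2 (by decide)
  have hprod : L 0 0 * L 1 1 * L 2 2 = 1 := by
    rw [Matrix.det_fin_three, h01, h02, h12] at hLdet
    linear_combination hLdet
  have hd : ∀ j, L j j ≠ 0 := by
    intro j hj
    fin_cases j <;> simp_all
  have htr : g.trace = L 0 0 + L 1 1 + L 2 2 := by
    rw [← trace_conj g, Matrix.trace_fin_three]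
  have htr' : h.trace = L 0 0 * L 1 1 + L 0 0 * L 2 2 + L 1 1 * L 2 2 := by
    rw [← trace_conj h, eq_comm]
    generalize Q * h * P = K at hLL
    have e := fun i j => congrFun (congrFun hLL i) j
    simp only [Matrix.mul_apply, Fin.sum_univ_three] at e
    have e00 := e 0 0
    have e01 := e 0 1
    have e02 := e 0 2
    have e11 := e 1 1
    have e12 := e 1 2
    have e22 := e 2 2
    simp [h01, h02, hd] at e00 e01 e02
    simp [h12, hd, e01, e02] at e11 e12
    simp [e02, e12] at e22
    rw [Matrix.trace_fin_three]
    linear_combination (- L 1 1 * L 2 2) * e00 - L 0 0 * L 2 2 * e11 - L 0 0 * L 1 1 * e22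
      + (K 0 0 + K 1 1 + K 2 2) * hprod
  have htrace : ∀ m, (symMatrix3 m g).trace = (symMatrix3 m L).trace := by
    intro m
    rw [hLdef, symMatrix3_mul, Matrix.trace_mul_comm, ← symMatrix3_mul, ← mul_assoc, hPQ, one_mul]
  simp only [htrace, trace_symMatrix3_of_lower hL hd, mk_sum_symIdx3]
  have hprod' := congrArg (PowerSeries.C (R := ℂ)) hprod
  rw [htr, htr']
  simp only [map_add, map_mul, map_one] at hprod' ⊢
  have e0 := one_sub_C_mul_X_mul_mk_pow (L 0 0)
  have e1 := one_sub_C_mul_X_mul_mk_pow (L 1 1)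
  have e2 := one_sub_C_mul_X_mul_mk_pow (L 2 2)
  generalize PowerSeries.mk (fun n => L 0 0 ^ n) = F0 at *
  generalize PowerSeries.mk (fun n => L 1 1 ^ n) = F1 at *
  generalize PowerSeries.mk (fun n => L 2 2 ^ n) = F2 at *
  generalize PowerSeries.C (L 0 0) = x at *
  generalize PowerSeries.C (L 1 1) = y at *
  generalize PowerSeries.C (L 2 2) = z at *
  linear_combination (1 - y * PowerSeries.X) * F1 * ((1 - z * PowerSeries.X) * F2) * e0 +
    (1 - z * PowerSeries.X) * F2 * e1 + e2 + PowerSeries.X ^ 3 * F0 * F1 * F2 * hprod'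

section KleinRelations

variable {A : Type*} [Ring A] {s t r : A}

theorem mul_sum_pow_seven (hs : s ^ 7 = 1) :
    s * ∑ a ∈ Finset.range 7, s ^ a = ∑ a ∈ Finset.range 7, s ^ a := by
  rw [Finset.mul_sum]
  simp only [← pow_succ', Finset.sum_range_succ, Finset.sum_range_zero, hs,
    pow_zero, zero_add]
  abel

theorem sum_pow_seven_mul_pow (hs : s ^ 7 = 1) (c : ℕ) :
    (∑ a ∈ Finset.range 7, s ^ a) * s ^ c = ∑ a ∈ Finset.range 7, s ^ a := by
  induction c with
  | zero => simp
  | succ c ih =>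
    rw [pow_succ, ← mul_assoc, ih, Finset.sum_mul]
    simp only [← pow_succ, Finset.sum_range_succ, Finset.sum_range_zero, hs, pow_zero, zero_add]
    abel

theorem mul_sum_pow_three (ht : t ^ 3 = 1) :
    t * ∑ b ∈ Finset.range 3, t ^ b = ∑ b ∈ Finset.range 3, t ^ b := by
  rw [Finset.mul_sum]
  simp only [← pow_succ', Finset.sum_range_succ, Finset.sum_range_zero, ht,
    pow_zero, zero_add]
  abel

theorem mul_sum_pow_seven_comm (hs : s ^ 7 = 1) (hts : t * s = s ^ 2 * t) :
    t * ∑ a ∈ Finset.range 7, s ^ a = (∑ a ∈ Finset.range 7, s ^ a) * t := by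
  have h : ∀ a, t * s ^ a = (s ^ 2) ^ a * t := fun a => (SemiconjBy.pow_right hts a : _)
  have h8 : s ^ 8 = s := by rw [pow_succ, hs, one_mul]
  have h10 : s ^ 10 = s ^ 3 := by rw [show 10 = 7 + 3 from rfl, pow_add, hs, one_mul]
  have h12 : s ^ 12 = s ^ 5 := by rw [show 12 = 7 + 5 from rfl, pow_add, hs, one_mul]
  rw [Finset.mul_sum, Finset.sum_congr rfl fun a _ => h a, ← Finset.sum_mul]
  congr 1
  simp only [Finset.sum_range_succ, Finset.sum_range_zero, ← pow_mul, Nat.reduceMul, h8, h10, h12]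
  simp only [pow_zero, pow_one]
  abel

theorem mul_pow_mul_of_mul_eq {e : A} (hs : s * e = e) (n : ℕ) : s ^ n * e = e := by
  induction n with
  | zero => simp
  | succ n ih => rw [pow_succ, mul_assoc, hs, ih]

variable (s t r) in
/-- The sum over the elements of the group of order `168`, written through its Bruhat
decomposition with respect to the Borel subgroup generated by `s` and `t`. -/
def kleinSum : A :=
  (∑ a ∈ Finset.range 7, s ^ a) * (∑ b ∈ Finset.range 3, t ^ b) +
    (∑ a ∈ Finset.range 7, s ^ a) * r *
      ((∑ a ∈ Finset.range 7, s ^ a) * ∑ b ∈ Finset.range 3, t ^ b)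

theorem mul_kleinSum_fst (hs : s ^ 7 = 1) : s * kleinSum s t r = kleinSum s t r := by
  simp only [kleinSum, mul_add, ← mul_assoc, mul_sum_pow_seven hs]

theorem mul_kleinSum_snd (hs : s ^ 7 = 1) (ht : t ^ 3 = 1) (hts : t * s = s ^ 2 * t)
    (htr : t * r = r * t ^ 2) : t * kleinSum s t r = kleinSum s t r := by
  have hσ := mul_sum_pow_seven_comm hs hts
  have hE : t * ((∑ a ∈ Finset.range 7, s ^ a) * ∑ b ∈ Finset.range 3, t ^ b) =
      (∑ a ∈ Finset.range 7, s ^ a) * ∑ b ∈ Finset.range 3, t ^ b := by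
    rw [← mul_assoc, hσ, mul_assoc, mul_sum_pow_three ht]
  rw [kleinSum]
  generalize (∑ a ∈ Finset.range 7, s ^ a) * ∑ b ∈ Finset.range 3, t ^ b = e at *
  rw [mul_add, hE, ← mul_assoc, ← mul_assoc t, hσ, mul_assoc _ t r, htr, ← mul_assoc,
    mul_assoc _ (t ^ 2) e, mul_pow_mul_of_mul_eq hE]

theorem mul_kleinSum_thd (hs : s ^ 7 = 1) (ht : t ^ 3 = 1) (hr : r * r = 1)
    (hts : t * s = s ^ 2 * t)
    (h1 : r * s * r = s ^ 3 * r * s ^ 6 * t)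
    (h2 : r * s ^ 2 * r = s ^ 5 * r * s ^ 5)
    (h3 : r * s ^ 3 * r = s * r * s ^ 4 * t ^ 2)
    (h4 : r * s ^ 4 * r = s ^ 6 * r * s ^ 3 * t ^ 2)
    (h5 : r * s ^ 5 * r = s ^ 2 * r * s ^ 2)
    (h6 : r * s ^ 6 * r = s ^ 4 * r * s * t) :
    r * kleinSum s t r = kleinSum s t r := by
  have hσ := mul_sum_pow_seven_comm hs hts
  have htE : t * ((∑ a ∈ Finset.range 7, s ^ a) * ∑ b ∈ Finset.range 3, t ^ b) =
      (∑ a ∈ Finset.range 7, s ^ a) * ∑ b ∈ Finset.range 3, t ^ b := by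
    rw [← mul_assoc, hσ, mul_assoc, mul_sum_pow_three ht]
  have hsE : s * ((∑ a ∈ Finset.range 7, s ^ a) * ∑ b ∈ Finset.range 3, t ^ b) =
      (∑ a ∈ Finset.range 7, s ^ a) * ∑ b ∈ Finset.range 3, t ^ b := by
    rw [← mul_assoc, mul_sum_pow_seven hs]
  rw [kleinSum]
  generalize (∑ a ∈ Finset.range 7, s ^ a) * ∑ b ∈ Finset.range 3, t ^ b = e at *
  have hsE' := mul_pow_mul_of_mul_eq hsE
  have htE' := mul_pow_mul_of_mul_eq htE
  have expand : r * ((∑ a ∈ Finset.range 7, s ^ a) * r * e) =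
      r * r * e + r * s * r * e + r * s ^ 2 * r * e + r * s ^ 3 * r * e + r * s ^ 4 * r * e +
        r * s ^ 5 * r * e + r * s ^ 6 * r * e := by
    simp only [Finset.sum_range_succ, Finset.sum_range_zero, pow_zero, pow_one, zero_add, add_mul,
      mul_add, one_mul, mul_assoc]
  rw [mul_add, expand, hr, h1, h2, h3, h4, h5, h6]
  simp only [Finset.sum_range_succ, Finset.sum_range_zero, pow_zero, pow_one, zero_add, add_mul,
    one_mul, mul_assoc, hsE, htE, hsE', htE']
  abel

theorem kleinSum_mulVec {ι : Type*} [Fintype ι] [DecidableEq ι] {s t r : Matrix ι ι ℂ} {v : ι → ℂ}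
    (hs : s.mulVec v = v) (ht : t.mulVec v = v) (hr : r.mulVec v = v) :
    (kleinSum s t r).mulVec v = (168 : ℂ) • v := by
  have hpow : ∀ {u : Matrix ι ι ℂ}, u.mulVec v = v → ∀ n : ℕ, (u ^ n).mulVec v = v := by
    intro u hu n
    induction n with
    | zero => simp
    | succ n ih => rw [pow_succ, ← Matrix.mulVec_mulVec, hu, ih]
  simp only [kleinSum, Matrix.add_mulVec, ← Matrix.mulVec_mulVec, Matrix.sum_mulVec, hpow ht,
    hpow hs, hr, Finset.sum_const, Finset.card_range, Matrix.mulVec_smul]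
  module

theorem trace_kleinSum {ι : Type*} [Fintype ι] [DecidableEq ι] {s t r : Matrix ι ι ℂ}
    (hs : s ^ 7 = 1) (ht : t ^ 3 = 1) (hts : t * s = s ^ 2 * t) (htr : t * r = r * t ^ 2) :
    (kleinSum s t r).trace =
      ∑ a ∈ Finset.range 7, ∑ b ∈ Finset.range 3, (s ^ a * t ^ b).trace +
        21 * ∑ a ∈ Finset.range 7, (r * s ^ a).trace := by
  have hσ := mul_sum_pow_seven_comm hs hts
  have hσσ : (∑ a ∈ Finset.range 7, s ^ a) * (∑ a ∈ Finset.range 7, s ^ a) =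
      7 • ∑ a ∈ Finset.range 7, s ^ a := by
    rw [Finset.mul_sum, Finset.sum_congr rfl fun a _ => sum_pow_seven_mul_pow hs a]
    simp
  have hEσ : ((∑ a ∈ Finset.range 7, s ^ a) * ∑ b ∈ Finset.range 3, t ^ b) *
      (∑ a ∈ Finset.range 7, s ^ a) =
      7 • ((∑ a ∈ Finset.range 7, s ^ a) * ∑ b ∈ Finset.range 3, t ^ b) := by
    have : Commute (∑ b ∈ Finset.range 3, t ^ b) (∑ a ∈ Finset.range 7, s ^ a) :=
      Commute.sum_left _ _ _ fun b _ => Commute.pow_left hσ b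
    rw [mul_assoc, this.eq, ← mul_assoc, hσσ, smul_mul_assoc]
  have step : ∀ b, (r * (∑ a ∈ Finset.range 7, s ^ a) * t ^ (b + 1)).trace =
      (r * (∑ a ∈ Finset.range 7, s ^ a) * t ^ b).trace := by
    intro b
    have h2 : t ^ 2 * (∑ a ∈ Finset.range 7, s ^ a) = (∑ a ∈ Finset.range 7, s ^ a) * t ^ 2 :=
      (Commute.pow_left hσ 2 : _)
    have e : t * (r * (∑ a ∈ Finset.range 7, s ^ a) * t ^ b) * t ^ 2 =
        r * (∑ a ∈ Finset.range 7, s ^ a) * t ^ (b + 1) := by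
      rw [← mul_assoc, ← mul_assoc, htr, mul_assoc r, h2]
      simp only [mul_assoc]
      rw [← pow_add, ← pow_add, show 2 + (b + 2) = 3 + (b + 1) by ring, pow_add, ht, one_mul]
    rw [← e, Matrix.trace_mul_comm, ← mul_assoc, ← pow_succ, ht, one_mul]
  have h1 := step 0
  have h2 := step 1
  rw [kleinSum, Matrix.trace_add]
  congr 1
  · simp only [Finset.sum_mul_sum, Matrix.trace_sum]
  · rw [mul_assoc, Matrix.trace_mul_comm, mul_assoc, hEσ, mul_smul_comm, Matrix.trace_smul,
      ← mul_assoc, ← Matrix.trace_sum, ← Finset.mul_sum]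
    simp only [Finset.sum_range_succ _ 2, Finset.sum_range_succ _ 1, Finset.sum_range_succ _ 0,
      Finset.range_zero, Finset.sum_empty, mul_add, Matrix.trace_add, h2]
    simp only [zero_add] at h1
    rw [h1]
    simp
    ring

end KleinRelations

theorem mem_symInvariants3_closure (X : Set (SpecialLinearGroup (Fin 3) ℂ)) (m : ℕ)
    (v : SymIdx3 m → ℂ) : v ∈ symInvariants3 (Subgroup.closure X) m ↔
      ∀ g ∈ X, (symMatrix3 m (g : Matrix (Fin 3) (Fin 3) ℂ)).mulVec v = v := by
  refine ⟨fun h g hg => h g (Subgroup.subset_closure hg), fun h g hg => ?_⟩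
  induction hg using Subgroup.closure_induction with
  | mem g hg => exact h g hg
  | one =>
    change (symMatrix3 m 1).mulVec v = v
    rw [symMatrix3_one, Matrix.one_mulVec]
  | mul g g' _ _ ih ih' =>
    change (symMatrix3 m (g.1 * g'.1)).mulVec v = v
    rw [symMatrix3_mul, ← Matrix.mulVec_mulVec, ih', ih]
  | inv g _ ih =>
    have hg : (g⁻¹).1 * g.1 = 1 := congrArg Subtype.val (inv_mul_cancel g)
    conv_lhs => rw [← ih]
    rw [Matrix.mulVec_mulVec, ← symMatrix3_mul, hg, symMatrix3_one, Matrix.one_mulVec]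

/-- The dimension of the invariants of the group of order `168`, as a character average. -/
theorem finrank_symInvariants3_klein {s t r : Matrix (Fin 3) (Fin 3) ℂ}
    (hsd : s.det = 1) (htd : t.det = 1) (hrd : r.det = 1)
    (hs : s ^ 7 = 1) (ht : t ^ 3 = 1) (hr : r * r = 1)
    (hts : t * s = s ^ 2 * t) (htr : t * r = r * t ^ 2)
    (h1 : r * s * r = s ^ 3 * r * s ^ 6 * t)
    (h2 : r * s ^ 2 * r = s ^ 5 * r * s ^ 5)
    (h3 : r * s ^ 3 * r = s * r * s ^ 4 * t ^ 2)
    (h4 : r * s ^ 4 * r = s ^ 6 * r * s ^ 3 * t ^ 2)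
    (h5 : r * s ^ 5 * r = s ^ 2 * r * s ^ 2)
    (h6 : r * s ^ 6 * r = s ^ 4 * r * s * t) (m : ℕ) :
    168 * (Module.finrank ℂ (symInvariants3 (Subgroup.closure
        {g : SpecialLinearGroup (Fin 3) ℂ | (g : Matrix (Fin 3) (Fin 3) ℂ) = s ∨
          (g : Matrix (Fin 3) (Fin 3) ℂ) = t ∨ (g : Matrix (Fin 3) (Fin 3) ℂ) = r}) m) : ℂ) =
      ∑ a ∈ Finset.range 7, ∑ b ∈ Finset.range 3, (symMatrix3 m (s ^ a * t ^ b)).trace +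
        21 * ∑ a ∈ Finset.range 7, (symMatrix3 m (r * s ^ a)).trace := by
  set V := symInvariants3 (Subgroup.closure
        {g : SpecialLinearGroup (Fin 3) ℂ | (g : Matrix (Fin 3) (Fin 3) ℂ) = s ∨
          (g : Matrix (Fin 3) (Fin 3) ℂ) = t ∨ (g : Matrix (Fin 3) (Fin 3) ℂ) = r}) m with hV
  have hmem : ∀ v, v ∈ V ↔ (symMatrix3 m s).mulVec v = v ∧ (symMatrix3 m t).mulVec v = v ∧
      (symMatrix3 m r).mulVec v = v := by
    intro v
    rw [hV, mem_symInvariants3_closure]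
    simp only [Set.mem_ofPred_eq]
    constructor
    · intro h
      have hs' := h ⟨s, hsd⟩
      have ht' := h ⟨t, htd⟩
      have hr' := h ⟨r, hrd⟩
      simp only [true_or, or_true, forall_const] at hs' ht' hr'
      exact ⟨hs', ht', hr'⟩
    · rintro ⟨hs', ht', hr'⟩ g (h | h | h) <;> rw [h]
      exacts [hs', ht', hr']
  let φ := symMatrixHom3 m
  have hφ : ∀ g, symMatrix3 m g = φ g := fun _ => rfl
  simp only [hφ] at hmem ⊢
  simp only [map_mul, map_pow]
  replace hs := congrArg φ hs
  replace ht := congrArg φ ht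
  replace hr := congrArg φ hr
  replace hts := congrArg φ hts
  replace htr := congrArg φ htr
  replace h1 := congrArg φ h1
  replace h2 := congrArg φ h2
  replace h3 := congrArg φ h3
  replace h4 := congrArg φ h4
  replace h5 := congrArg φ h5
  replace h6 := congrArg φ h6
  simp only [map_mul, map_pow, map_one] at hs ht hr hts htr h1 h2 h3 h4 h5 h6
  have hproj : LinearMap.IsProj V
      ((168 : ℂ)⁻¹ • Matrix.toLin' (kleinSum (φ s) (φ t) (φ r))) := by
    constructor
    · intro v
      rw [LinearMap.smul_apply, Matrix.toLin'_apply]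
      refine V.smul_mem _ ((hmem _).2 ⟨?_, ?_, ?_⟩) <;> rw [Matrix.mulVec_mulVec]
      · rw [mul_kleinSum_fst hs]
      · rw [mul_kleinSum_snd hs ht hts htr]
      · rw [mul_kleinSum_thd hs ht hr hts h1 h2 h3 h4 h5 h6]
    · intro v hv
      obtain ⟨hvs, hvt, hvr⟩ := (hmem v).1 hv
      rw [LinearMap.smul_apply, Matrix.toLin'_apply, kleinSum_mulVec hvs hvt hvr,
        inv_smul_smul₀ (by norm_num)]
  rw [← hproj.trace, map_smul, Matrix.trace_toLin'_eq, trace_kleinSum hs ht hts htr, smul_eq_mul,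
    mul_inv_cancel_left₀ (by norm_num)]

section SeventhRoot

variable {ζ : ℂ}

theorem isPrimitiveRoot_sum_eq_zero (hζ : ζ = Complex.exp (2 * (Real.pi : ℂ) * Complex.I / 7)) :
    1 + ζ + ζ ^ 2 + ζ ^ 3 + ζ ^ 4 + ζ ^ 5 + ζ ^ 6 = 0 := by
  have h := (Complex.isPrimitiveRoot_exp 7 (by norm_num)).geom_sum_eq_zero (by norm_num)
  push_cast at h
  rw [← hζ] at h
  simpa [Finset.sum_range_succ] using h

/-- The quadratic Gauss sum modulo `7`, with its sign. -/
theorem gauss_sum_seven (hζ : ζ = Complex.exp (2 * (Real.pi : ℂ) * Complex.I / 7)) :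
    Complex.I / (Real.sqrt 7 : ℂ) = (ζ + ζ ^ 2 + ζ ^ 4 - ζ ^ 3 - ζ ^ 5 - ζ ^ 6) / 7 := by
  have h0 := isPrimitiveRoot_sum_eq_zero hζ
  set w := ζ + ζ ^ 2 + ζ ^ 4 - ζ ^ 3 - ζ ^ 5 - ζ ^ 6 with hw
  have hsq : ((Real.sqrt 7 : ℝ) : ℂ) * (Real.sqrt 7 : ℝ) = 7 := by
    rw [← Complex.ofReal_mul, Real.mul_self_sqrt (by norm_num)]
    norm_num
  have hne : ((Real.sqrt 7 : ℝ) : ℂ) ≠ 0 := by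
    intro h
    simp [h] at hsq
  have hw2 : (w - Complex.I * (Real.sqrt 7 : ℝ)) * (w + Complex.I * (Real.sqrt 7 : ℝ)) = 0 := by
    have : w * w = -7 := by grind
    linear_combination this - (Real.sqrt 7 : ℂ) * (Real.sqrt 7 : ℂ) * Complex.I_mul_I + hsq
  have him : ∀ k : ℕ, (ζ ^ k).im = Real.sin (2 * k * (Real.pi / 7)) := by
    intro k
    rw [hζ, ← Complex.exp_nat_mul, show (k : ℂ) * (2 * (Real.pi : ℂ) * Complex.I / 7) =
      ((2 * k * (Real.pi / 7) : ℝ) : ℂ) * Complex.I by push_cast; ring,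
      Complex.exp_ofReal_mul_I_im]
  have hpi := Real.pi_pos
  have hpos : 0 < w.im := by
    have e1 := him 1
    have e2 := him 2
    have e3 := him 3
    have e4 := him 4
    have e5 := him 5
    have e6 := him 6
    push_cast at e1 e2 e3 e4 e5 e6
    rw [show 2 * 2 * (Real.pi / 7) = Real.pi - 3 * (Real.pi / 7) by ring,
      Real.sin_pi_sub] at e2
    rw [show 2 * 3 * (Real.pi / 7) = Real.pi - Real.pi / 7 by ring, Real.sin_pi_sub] at e3
    rw [show 2 * 4 * (Real.pi / 7) = Real.pi / 7 + Real.pi by ring, Real.sin_add_pi] at e4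
    rw [show 2 * 5 * (Real.pi / 7) = 3 * (Real.pi / 7) + Real.pi by ring,
      Real.sin_add_pi] at e5
    rw [show 2 * 6 * (Real.pi / 7) = 2 * Real.pi - 2 * 1 * (Real.pi / 7) by ring,
      Real.sin_two_pi_sub] at e6
    have hlt : Real.sin (Real.pi / 7) < Real.sin (2 * 1 * (Real.pi / 7)) :=
      Real.sin_lt_sin_of_lt_of_le_pi_div_two (by linarith) (by linarith) (by linarith)
    have h3 : 0 < Real.sin (3 * (Real.pi / 7)) :=
      Real.sin_pos_of_pos_of_lt_pi (by linarith) (by linarith)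
    rw [pow_one] at e1
    simp only [hw, Complex.sub_im, Complex.add_im, e1, e2, e3, e4, e5, e6]
    linarith
  rcases mul_eq_zero.1 hw2 with h | h
  · rw [div_eq_div_iff hne (by norm_num)]
    linear_combination (-(Real.sqrt 7 : ℂ)) * h - Complex.I * hsq
  · have h' := congrArg Complex.im h
    simp at h'
    have := Real.sqrt_nonneg 7
    linarith

theorem diag_pow (ζ : ℂ) (n : ℕ) : !![ζ, 0, 0; 0, ζ ^ 2, 0; 0, 0, ζ ^ 4] ^ n =
    !![ζ ^ n, 0, 0; 0, (ζ ^ 2) ^ n, 0; 0, 0, (ζ ^ 4) ^ n] := by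
  induction n with
  | zero => ext i j; fin_cases i <;> fin_cases j <;> simp
  | succ n ih =>
    rw [pow_succ, ih]
    ext i j
    fin_cases i <;> fin_cases j <;> simp [Matrix.mul_apply, Fin.sum_univ_three, pow_succ]

theorem cyclic_sq : !![0, 1, 0; 0, 0, 1; 1, 0, 0] ^ 2 =
    (!![0, 0, 1; 1, 0, 0; 0, 1, 0] : Matrix (Fin 3) (Fin 3) ℂ) := by
  rw [pow_two]
  ext i j
  fin_cases i <;> fin_cases j <;> simp [Matrix.mul_apply, Fin.sum_univ_three]

variable {S T R : Matrix (Fin 3) (Fin 3) ℂ}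

theorem klein_relations (h0 : 1 + ζ + ζ ^ 2 + ζ ^ 3 + ζ ^ 4 + ζ ^ 5 + ζ ^ 6 = 0)
    (hS : S = !![ζ, 0, 0; 0, ζ ^ 2, 0; 0, 0, ζ ^ 4])
    (hT : T = !![0, 1, 0; 0, 0, 1; 1, 0, 0])
    (hR : R = ((ζ + ζ ^ 2 + ζ ^ 4 - ζ ^ 3 - ζ ^ 5 - ζ ^ 6) / 7) •
      !![ζ ^ 4 - ζ ^ 3, ζ ^ 2 - ζ ^ 5, ζ - ζ ^ 6;
         ζ ^ 2 - ζ ^ 5, ζ - ζ ^ 6, ζ ^ 4 - ζ ^ 3;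
         ζ - ζ ^ 6, ζ ^ 4 - ζ ^ 3, ζ ^ 2 - ζ ^ 5]) :
    S.det = 1 ∧ T.det = 1 ∧ R.det = 1 ∧ S ^ 7 = 1 ∧ T ^ 3 = 1 ∧ R * R = 1 ∧
      T * S = S ^ 2 * T ∧ T * R = R * T ^ 2 := by
  have h7 : ζ ^ 7 = 1 := by linear_combination (ζ - 1) * h0
  refine ⟨?_, ?_, ?_, ?_, ?_, ?_, ?_, ?_⟩
  · rw [hS, Matrix.det_fin_three]
    simp
    grind
  · rw [hT, Matrix.det_fin_three]
    simp
  · rw [hR, Matrix.det_smul, Matrix.det_fin_three]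
    simp
    grind
  · rw [hS, diag_pow]
    ext i j
    fin_cases i <;> fin_cases j <;> simp <;> grind
  · rw [pow_succ, hT, cyclic_sq]
    ext i j
    fin_cases i <;> fin_cases j <;> simp [Matrix.mul_apply, Fin.sum_univ_three]
  · rw [hR]
    ext i j
    fin_cases i <;> fin_cases j <;> simp [Matrix.mul_apply, Fin.sum_univ_three] <;> grind
  · rw [hS, diag_pow, hT]
    ext i j
    fin_cases i <;> fin_cases j <;> simp [Matrix.mul_apply, Fin.sum_univ_three] <;> grind
  · rw [hR, hT, cyclic_sq]
    ext i j
    fin_cases i <;> fin_cases j <;> simp [Matrix.mul_apply, Fin.sum_univ_three]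

theorem klein_bruhat_one (h0 : 1 + ζ + ζ ^ 2 + ζ ^ 3 + ζ ^ 4 + ζ ^ 5 + ζ ^ 6 = 0)
    (hS : S = !![ζ, 0, 0; 0, ζ ^ 2, 0; 0, 0, ζ ^ 4])
    (hT : T = !![0, 1, 0; 0, 0, 1; 1, 0, 0])
    (hR : R = ((ζ + ζ ^ 2 + ζ ^ 4 - ζ ^ 3 - ζ ^ 5 - ζ ^ 6) / 7) •
      !![ζ ^ 4 - ζ ^ 3, ζ ^ 2 - ζ ^ 5, ζ - ζ ^ 6;
         ζ ^ 2 - ζ ^ 5, ζ - ζ ^ 6, ζ ^ 4 - ζ ^ 3;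
         ζ - ζ ^ 6, ζ ^ 4 - ζ ^ 3, ζ ^ 2 - ζ ^ 5]) :
    R * S * R = S ^ 3 * R * S ^ 6 * T := by
  have h7 : ζ ^ 7 = 1 := by linear_combination (ζ - 1) * h0
  rw [hT]
  simp only [hS, diag_pow]
  rw [hR]
  ext i j
  fin_cases i <;> fin_cases j <;> simp [Matrix.mul_apply, Fin.sum_univ_three] <;> grind

theorem trace_klein (h0 : 1 + ζ + ζ ^ 2 + ζ ^ 3 + ζ ^ 4 + ζ ^ 5 + ζ ^ 6 = 0)
    (hS : S = !![ζ, 0, 0; 0, ζ ^ 2, 0; 0, 0, ζ ^ 4])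
    (hR : R = ((ζ + ζ ^ 2 + ζ ^ 4 - ζ ^ 3 - ζ ^ 5 - ζ ^ 6) / 7) •
      !![ζ ^ 4 - ζ ^ 3, ζ ^ 2 - ζ ^ 5, ζ - ζ ^ 6;
         ζ ^ 2 - ζ ^ 5, ζ - ζ ^ 6, ζ ^ 4 - ζ ^ 3;
         ζ - ζ ^ 6, ζ ^ 4 - ζ ^ 3, ζ ^ 2 - ζ ^ 5]) :
    R.trace = -1 ∧ (R * S).trace = 1 ∧ (R * S ^ 2).trace = 0 ∧
      (R * S ^ 3).trace = ζ + ζ ^ 2 + ζ ^ 4 ∧ (R * S ^ 4).trace = ζ ^ 3 + ζ ^ 5 + ζ ^ 6 ∧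
      (R * S ^ 5).trace = 0 ∧ (R * S ^ 6).trace = 1 := by
  have h7 : ζ ^ 7 = 1 := by linear_combination (ζ - 1) * h0
  simp only [hS, diag_pow]
  rw [hR]
  refine ⟨?_, ?_, ?_, ?_, ?_, ?_, ?_⟩ <;>
    simp [Matrix.trace_fin_three] <;> grind

theorem trace_diag (h0 : 1 + ζ + ζ ^ 2 + ζ ^ 3 + ζ ^ 4 + ζ ^ 5 + ζ ^ 6 = 0)
    (hS : S = !![ζ, 0, 0; 0, ζ ^ 2, 0; 0, 0, ζ ^ 4]) :
    S.trace = ζ + ζ ^ 2 + ζ ^ 4 ∧ (S ^ 2).trace = ζ + ζ ^ 2 + ζ ^ 4 ∧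
      (S ^ 3).trace = ζ ^ 3 + ζ ^ 5 + ζ ^ 6 ∧ (S ^ 4).trace = ζ + ζ ^ 2 + ζ ^ 4 ∧
      (S ^ 5).trace = ζ ^ 3 + ζ ^ 5 + ζ ^ 6 ∧ (S ^ 6).trace = ζ ^ 3 + ζ ^ 5 + ζ ^ 6 := by
  have h7 : ζ ^ 7 = 1 := by linear_combination (ζ - 1) * h0
  simp only [hS, diag_pow]
  refine ⟨?_, ?_, ?_, ?_, ?_, ?_⟩ <;> simp [Matrix.trace_fin_three] <;> grind

theorem trace_diag_mul_cyclic
    (hS : S = !![ζ, 0, 0; 0, ζ ^ 2, 0; 0, 0, ζ ^ 4])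
    (hT : T = !![0, 1, 0; 0, 0, 1; 1, 0, 0]) (a : ℕ) :
    (S ^ a * T).trace = 0 ∧ (S ^ a * T ^ 2).trace = 0 := by
  rw [hS, hT, cyclic_sq, diag_pow]
  constructor <;> simp [Matrix.trace_fin_three]

end SeventhRoot

/-- Conjugation by `t` and inversion produce all the relations `r * s ^ c * r = …` of the Klein
group from the one for `c = 1`. -/
theorem klein_bruhat_of_one {M : Type*} [Monoid M] {s t r : M}
    (hs : s ^ 7 = 1) (ht : t ^ 3 = 1) (hr : r * r = 1)
    (hts : t * s = s ^ 2 * t) (htr : t * r = r * t ^ 2)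
    (h1 : r * s * r = s ^ 3 * r * s ^ 6 * t) :
    r * s ^ 2 * r = s ^ 5 * r * s ^ 5 ∧ r * s ^ 3 * r = s * r * s ^ 4 * t ^ 2 ∧
      r * s ^ 4 * r = s ^ 6 * r * s ^ 3 * t ^ 2 ∧ r * s ^ 5 * r = s ^ 2 * r * s ^ 2 ∧
      r * s ^ 6 * r = s ^ 4 * r * s * t := by
  have hs' : s * (s * (s * (s * (s * (s * s))))) = 1 := by
    simpa [pow_succ, mul_assoc] using hs
  have ht' : t * (t * t) = 1 := by simpa [pow_succ, mul_assoc] using ht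
  have hts' : t * s = s * (s * t) := by simpa [pow_succ, mul_assoc] using hts
  have htr' : t * r = r * (t * t) := by simpa [pow_succ, mul_assoc] using htr
  have es : ∀ x, s * (s * (s * (s * (s * (s * (s * x)))))) = x := fun x => by
    simpa [mul_assoc] using congrArg (· * x) hs'
  have et : ∀ x, t * (t * (t * x)) = x := fun x => by
    simpa [mul_assoc] using congrArg (· * x) ht'
  have er : ∀ x, r * (r * x) = x := fun x => by rw [← mul_assoc, hr, one_mul]
  have ets : ∀ x, t * (s * x) = s * (s * (t * x)) := fun x => by
    simpa [mul_assoc] using congrArg (· * x) hts'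
  have etr : ∀ x, t * (r * x) = r * (t * (t * x)) := fun x => by
    simpa [mul_assoc] using congrArg (· * x) htr'
  have h4 : r * s ^ 4 * r = s ^ 6 * r * s ^ 3 * t ^ 2 := by
    have : r * s ^ 4 * r = t * (r * s * r) * t ^ 2 := by
      simp only [pow_succ, pow_zero, one_mul, mul_assoc, ets, etr, htr', ht', mul_one]
    rw [this, h1]
    simp only [pow_succ, pow_zero, one_mul, mul_assoc, ets, etr, es, ht', hs',
      mul_one]
  have h2 : r * s ^ 2 * r = s ^ 5 * r * s ^ 5 := by
    have : r * s ^ 2 * r = t * (r * s ^ 4 * r) * t ^ 2 := by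
      simp only [pow_succ, pow_zero, one_mul, mul_assoc, ets, etr, es, htr', ht', mul_one]
    rw [this, h4]
    simp only [pow_succ, pow_zero, one_mul, mul_assoc, ets, etr, es, hts', ht',
      mul_one]
  have h6 : r * s ^ 6 * r = s ^ 4 * r * s * t := by
    have : r * s ^ 6 * r = s ^ 4 * r * s * t * (s ^ 3 * r * s ^ 6 * t) * (r * s ^ 6 * r) := by
      simp only [pow_succ, pow_zero, one_mul, mul_assoc, ets, etr, es, et, er]
    rw [this, ← h1]
    simp only [pow_succ, pow_zero, one_mul, mul_assoc, es, er, hr, mul_one]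
  have h3 : r * s ^ 3 * r = s * r * s ^ 4 * t ^ 2 := by
    have : r * s ^ 3 * r = t * (r * s ^ 6 * r) * t ^ 2 := by
      simp only [pow_succ, pow_zero, one_mul, mul_assoc, ets, etr, es, htr', ht', mul_one]
    rw [this, h6]
    simp only [pow_succ, pow_zero, one_mul, mul_assoc, ets, etr, es, ht',
      mul_one]
  have h5 : r * s ^ 5 * r = s ^ 2 * r * s ^ 2 := by
    have : r * s ^ 5 * r = t * (r * s ^ 3 * r) * t ^ 2 := by
      simp only [pow_succ, pow_zero, one_mul, mul_assoc, ets, etr, es, htr', ht', mul_one]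
    rw [this, h3]
    simp only [pow_succ, pow_zero, one_mul, mul_assoc, ets, etr, hts', ht', hs',
      mul_one]
  exact ⟨h2, h3, h4, h5, h6⟩

/-- The part of Molien's formula for the Klein group that is polynomial algebra: `E` is the
invariant series, and the other power series are the reciprocals of the characteristic
polynomials of its conjugacy classes. -/
theorem klein_molien_sum {a b : ℂ} (hab : a + b = -1) (hab2 : a * b = 2)
    {E F₁ F₂ F₃ F₄ Fa Fb : PowerSeries ℂ}
    (h₁ : (1 - PowerSeries.X) ^ 3 * F₁ = 1)
    (h₂ : (1 + PowerSeries.X - PowerSeries.X ^ 2 - PowerSeries.X ^ 3) * F₂ = 1)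
    (h₃ : (1 - PowerSeries.X ^ 3) * F₃ = 1)
    (h₄ : (1 - PowerSeries.X + PowerSeries.X ^ 2 - PowerSeries.X ^ 3) * F₄ = 1)
    (ha : (1 - PowerSeries.C a * PowerSeries.X + PowerSeries.C b * PowerSeries.X ^ 2 -
      PowerSeries.X ^ 3) * Fa = 1)
    (hb : (1 - PowerSeries.C b * PowerSeries.X + PowerSeries.C a * PowerSeries.X ^ 2 -
      PowerSeries.X ^ 3) * Fb = 1)
    (hE : 168 * E = F₁ + 21 * F₂ + 56 * F₃ + 42 * F₄ + 24 * Fa + 24 * Fb) :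
    (PowerSeries.X - 1) ^ 3 * (PowerSeries.X ^ 2 + PowerSeries.X + 1) *
        (PowerSeries.X ^ 2 + 1) * (PowerSeries.X + 1) ^ 2 *
        (PowerSeries.X ^ 6 + PowerSeries.X ^ 5 + PowerSeries.X ^ 4 + PowerSeries.X ^ 3
          + PowerSeries.X ^ 2 + PowerSeries.X + 1) * E =
      -PowerSeries.X ^ 12 - PowerSeries.X ^ 11 + PowerSeries.X ^ 9 + PowerSeries.X ^ 8
        - PowerSeries.X ^ 6 + PowerSeries.X ^ 4 + PowerSeries.X ^ 3 - PowerSeries.X - 1 := by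
  have hA : PowerSeries.C a + PowerSeries.C b = -1 := by
    rw [← map_add, hab, map_neg, map_one]
  have hB : PowerSeries.C a * PowerSeries.C b = 2 := by
    rw [← map_mul, hab2, map_ofNat]
  have h168 : (168 : PowerSeries ℂ) ≠ 0 := by
    rw [← map_ofNat (PowerSeries.C (R := ℂ)), Ne, map_eq_zero_iff _ PowerSeries.C_injective]
    norm_num
  refine mul_left_cancel₀ h168 ?_
  generalize PowerSeries.C a = A at *
  generalize PowerSeries.C b = B at *
  generalize (PowerSeries.X : PowerSeries ℂ) = x at *
  have hΦ : (1 - A * x + B * x ^ 2 - x ^ 3) * (1 - B * x + A * x ^ 2 - x ^ 3) =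
      x ^ 6 + x ^ 5 + x ^ 4 + x ^ 3 + x ^ 2 + x + 1 := by
    obtain rfl : B = -1 - A := by linear_combination hA
    linear_combination (x ^ 2 + 2 * x ^ 3 + x ^ 4) * hB
  have na : (x ^ 6 + x ^ 5 + x ^ 4 + x ^ 3 + x ^ 2 + x + 1) * Fa =
      1 - B * x + A * x ^ 2 - x ^ 3 := by
    rw [← hΦ]
    linear_combination (1 - B * x + A * x ^ 2 - x ^ 3) * ha
  have nb : (x ^ 6 + x ^ 5 + x ^ 4 + x ^ 3 + x ^ 2 + x + 1) * Fb =
      1 - A * x + B * x ^ 2 - x ^ 3 := by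
    rw [← hΦ]
    linear_combination (1 - A * x + B * x ^ 2 - x ^ 3) * hb
  set Φ := x ^ 6 + x ^ 5 + x ^ 4 + x ^ 3 + x ^ 2 + x + 1 with hΦx
  have hsum : (x - 1) ^ 3 * (x ^ 2 + x + 1) * (x ^ 2 + 1) * (x + 1) ^ 2 * Φ * (168 * E) =
      -(x ^ 2 + x + 1) * (x ^ 2 + 1) * (x + 1) ^ 2 * Φ
      - 21 * (x - 1) ^ 2 * (x ^ 2 + x + 1) * (x ^ 2 + 1) * Φ
      - 56 * (x - 1) ^ 2 * (x ^ 2 + 1) * (x + 1) ^ 2 * Φ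
      - 42 * (x - 1) ^ 2 * (x ^ 2 + x + 1) * (x + 1) ^ 2 * Φ
      + 24 * (x - 1) ^ 3 * (x ^ 2 + x + 1) * (x ^ 2 + 1) * (x + 1) ^ 2 *
        (2 + x - x ^ 2 - 2 * x ^ 3) := by
    rw [hE]
    linear_combination (-(x ^ 2 + x + 1) * (x ^ 2 + 1) * (x + 1) ^ 2 * Φ) * h₁
      - (21 * (x - 1) ^ 2 * (x ^ 2 + x + 1) * (x ^ 2 + 1) * Φ) * h₂
      - (56 * (x - 1) ^ 2 * (x ^ 2 + 1) * (x + 1) ^ 2 * Φ) * h₃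
      - (42 * (x - 1) ^ 2 * (x ^ 2 + x + 1) * (x + 1) ^ 2 * Φ) * h₄
      + (24 * (x - 1) ^ 3 * (x ^ 2 + x + 1) * (x ^ 2 + 1) * (x + 1) ^ 2) *
        (na + nb + (x ^ 2 - x) * hA)
  rw [hΦx] at hsum ⊢
  linear_combination hsum

/-- Type `I` (the exceptional subgroup `Γ = ⟨S, T, R⟩` of `SL₃(ℂ)`):
`(t−1)³(t²+t+1)(t²+1)(t+1)²(t⁶+t⁵+t⁴+t³+t²+t+1) · Σₘ dim (Symᵐ(ℂ³))^Γ · tᵐ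
  = −t¹² − t¹¹ + t⁹ + t⁸ − t⁶ + t⁴ + t³ − t − 1` in `ℂ⟦t⟧`. -/
theorem typeI_invariant_series
    (ζ : ℂ) (hζ : ζ = Complex.exp (2 * (Real.pi : ℂ) * Complex.I / 7))
    (S T R : Matrix (Fin 3) (Fin 3) ℂ)
    (hS : S = !![ζ, 0, 0; 0, ζ ^ 2, 0; 0, 0, ζ ^ 4])
    (hT : T = !![0, 1, 0; 0, 0, 1; 1, 0, 0])
    (hR : R = (Complex.I / (Real.sqrt 7 : ℂ)) •
      !![ζ ^ 4 - ζ ^ 3, ζ ^ 2 - ζ ^ 5, ζ - ζ ^ 6;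
         ζ ^ 2 - ζ ^ 5, ζ - ζ ^ 6, ζ ^ 4 - ζ ^ 3;
         ζ - ζ ^ 6, ζ ^ 4 - ζ ^ 3, ζ ^ 2 - ζ ^ 5])
    (Γ : Subgroup (SpecialLinearGroup (Fin 3) ℂ))
    (hΓ : Γ = Subgroup.closure {g : SpecialLinearGroup (Fin 3) ℂ |
      (g : Matrix (Fin 3) (Fin 3) ℂ) = S ∨ (g : Matrix (Fin 3) (Fin 3) ℂ) = T ∨
        (g : Matrix (Fin 3) (Fin 3) ℂ) = R}) :
    (PowerSeries.X - 1) ^ 3 * (PowerSeries.X ^ 2 + PowerSeries.X + 1) *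
        (PowerSeries.X ^ 2 + 1) * (PowerSeries.X + 1) ^ 2 *
        (PowerSeries.X ^ 6 + PowerSeries.X ^ 5 + PowerSeries.X ^ 4 + PowerSeries.X ^ 3
          + PowerSeries.X ^ 2 + PowerSeries.X + 1) *
        PowerSeries.mk (fun m => (Module.finrank ℂ (symInvariants3 Γ m) : ℂ)) =
      -PowerSeries.X ^ 12 - PowerSeries.X ^ 11 + PowerSeries.X ^ 9 + PowerSeries.X ^ 8
        - PowerSeries.X ^ 6 + PowerSeries.X ^ 4 + PowerSeries.X ^ 3 - PowerSeries.X - 1 := by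
  have hz := isPrimitiveRoot_sum_eq_zero hζ
  rw [gauss_sum_seven hζ] at hR
  obtain ⟨hSd, hTd, hRd, hS7, hT3, hRR, hTS, hTR⟩ := klein_relations hz hS hT hR
  have hb1 := klein_bruhat_one hz hS hT hR
  obtain ⟨hb2, hb3, hb4, hb5, hb6⟩ := klein_bruhat_of_one hS7 hT3 hRR hTS hTR hb1
  obtain ⟨tR0, tR1, tR2, tR3, tR4, tR5, tR6⟩ := trace_klein hz hS hR
  obtain ⟨tS1, tS2, tS3, tS4, tS5, tS6⟩ := trace_diag hz hS
  have tST := trace_diag_mul_cyclic hS hT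
  set α := ζ + ζ ^ 2 + ζ ^ 4 with hα
  set β := ζ ^ 3 + ζ ^ 5 + ζ ^ 6 with hβ
  have hαβ : α + β = -1 := by linear_combination hz
  have hαβ2 : α * β = 2 := by
    rw [hα, hβ]
    linear_combination (ζ ^ 4 + 2 * ζ - 2) * hz
  set F : Matrix (Fin 3) (Fin 3) ℂ → PowerSeries ℂ := fun g =>
    PowerSeries.mk (fun m => (symMatrix3 m g).trace) with hF
  have key : ∀ {g h : Matrix (Fin 3) (Fin 3) ℂ} {a b : ℂ}, g * h = 1 → g.det = 1 →
      g.trace = a → h.trace = b →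
      (1 - PowerSeries.C a * PowerSeries.X + PowerSeries.C b * PowerSeries.X ^ 2 -
        PowerSeries.X ^ 3) * F g = 1 := by
    rintro g h _ _ hgh hg rfl rfl
    exact molien_mul_trace hgh hg
  have unit : ∀ {p G G' : PowerSeries ℂ}, p * G = 1 → p * G' = 1 → G' = G := by
    intro p G G' h h'
    linear_combination G * h' - G' * h
  have hSS : ∀ a b : ℕ, a + b = 7 → S ^ a * S ^ b = 1 := by
    intro a b hab
    rw [← pow_add, hab, hS7]
  have hRS : ∀ a b : ℕ, a + b = 7 → R * S ^ a * (S ^ b * R) = 1 := by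
    intro a b hab
    rw [mul_assoc, ← mul_assoc (S ^ a), hSS a b hab, one_mul, hRR]
  have hST : ∀ a b c d : ℕ, a + b = 7 → c + d = 3 →
      S ^ a * T ^ c * (T ^ d * S ^ b) = 1 := by
    intro a b c d hab hcd
    rw [mul_assoc, ← mul_assoc (T ^ c), ← pow_add, hcd, hT3, one_mul, hSS a b hab]
  have dS : ∀ a : ℕ, (S ^ a).det = 1 := fun a => by rw [Matrix.det_pow, hSd, one_pow]
  have dRS : ∀ a : ℕ, (R * S ^ a).det = 1 := fun a => by rw [Matrix.det_mul, hRd, dS, one_mul]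
  have dST : ∀ a c : ℕ, (S ^ a * T ^ c).det = 1 := fun a c => by
    rw [Matrix.det_mul, dS, Matrix.det_pow, hTd, one_pow, one_mul]
  have tSR : ∀ {a : ℕ} {x : ℂ}, (R * S ^ a).trace = x → (S ^ a * R).trace = x := by
    intro a x h
    rw [Matrix.trace_mul_comm, h]
  have f1 := key (one_mul (1 : Matrix (Fin 3) (Fin 3) ℂ)) Matrix.det_one
    (Matrix.trace_one (n := Fin 3)) (Matrix.trace_one (n := Fin 3))
  have fa1 := key (hSS 1 6 rfl) (dS 1) (by rw [pow_one, tS1]) tS6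
  have fa2 := key (hSS 2 5 rfl) (dS 2) tS2 tS5
  have fb3 := key (hSS 3 4 rfl) (dS 3) tS3 tS4
  have fa4 := key (hSS 4 3 rfl) (dS 4) tS4 tS3
  have fb5 := key (hSS 5 2 rfl) (dS 5) tS5 tS2
  have fb6 := key (hSS 6 1 rfl) (dS 6) tS6 (by rw [pow_one, tS1])
  have g0 := key hRR hRd tR0 tR0
  have g1 := key (hRS 1 6 rfl) (dRS 1) (by rw [pow_one, tR1]) (tSR tR6)
  have g2 := key (hRS 2 5 rfl) (dRS 2) tR2 (tSR tR5)
  have g3 := key (hRS 3 4 rfl) (dRS 3) tR3 (tSR tR4)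
  have g4 := key (hRS 4 3 rfl) (dRS 4) tR4 (tSR tR3)
  have g5 := key (hRS 5 2 rfl) (dRS 5) tR5 (tSR tR2)
  have g6 := key (hRS 6 1 rfl) (dRS 6) tR6 (tSR (by rw [pow_one, tR1]))
  have f31 : ∀ a < 7, F (S ^ a * T) = F (R * S ^ 2) := by
    intro a ha
    refine unit g2 (key (h := T ^ 2 * S ^ (7 - a)) ?_ ?_ (tST a).1 ?_)
    · simpa using hST a (7 - a) 1 2 (by omega) rfl
    · simpa using dST a 1
    · rw [Matrix.trace_mul_comm, (tST _).2]
  have f32 : ∀ a < 7, F (S ^ a * T ^ 2) = F (R * S ^ 2) := by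
    intro a ha
    refine unit g2 (key (h := T * S ^ (7 - a)) ?_ (dST a 2) (tST a).2 ?_)
    · simpa using hST a (7 - a) 2 1 (by omega) rfl
    · rw [Matrix.trace_mul_comm, (tST _).1]
  have hE : 168 * PowerSeries.mk (fun m => (Module.finrank ℂ (symInvariants3 Γ m) : ℂ)) =
      ∑ a ∈ Finset.range 7, ∑ b ∈ Finset.range 3, F (S ^ a * T ^ b) +
        21 * ∑ a ∈ Finset.range 7, F (R * S ^ a) := by
    rw [← map_ofNat (PowerSeries.C (R := ℂ)) 168, ← map_ofNat (PowerSeries.C (R := ℂ)) 21]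
    ext m
    simp only [map_add, map_sum, PowerSeries.coeff_C_mul, hF, PowerSeries.coeff_mk]
    rw [hΓ]
    exact finrank_symInvariants3_klein hSd hTd hRd hS7 hT3 hRR hTS hTR hb1 hb2 hb3 hb4 hb5 hb6 m
  simp only [Finset.sum_range_succ, Finset.sum_range_zero, zero_add, pow_zero, mul_one, one_mul,
    pow_one] at hE fa1 g1
  have h30 : F T = F (R * S ^ 2) := by simpa using f31 0 (by norm_num)
  have h31 : F (S * T) = F (R * S ^ 2) := by simpa using f31 1 (by norm_num)
  have h302 : F (T ^ 2) = F (R * S ^ 2) := by simpa using f32 0 (by norm_num)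
  have h312 : F (S * T ^ 2) = F (R * S ^ 2) := by simpa using f32 1 (by norm_num)
  refine klein_molien_sum hαβ hαβ2 (F₁ := F 1) (F₂ := F R) (F₃ := F (R * S ^ 2))
    (F₄ := F (R * S)) (Fa := F S) (Fb := F (S ^ 3)) ?_ ?_ ?_ ?_ fa1 fb3 ?_
  · simp only [Fintype.card_fin, Nat.cast_ofNat, map_ofNat] at f1
    linear_combination f1
  · simp only [map_neg, map_one] at g0
    linear_combination g0
  · simpa using g2
  · simpa using g1
  · rw [hE, h30, h31, h302, h312, f31 2 (by norm_num), f31 3 (by norm_num),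
      f31 4 (by norm_num), f31 5 (by norm_num), f31 6 (by norm_num), f32 2 (by norm_num),
      f32 3 (by norm_num), f32 4 (by norm_num), f32 5 (by norm_num), f32 6 (by norm_num),
      unit fa1 fa2, unit fa1 fa4, unit fb3 fb5, unit fb3 fb6, unit fa1 g3, unit fb3 g4,
      unit g2 g5, unit g1 g6]
    ring
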